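/- arXiv:2305.02434 — 7 statements merged into one kernel-verified Lean document; each statement's English description precedes it below -/
import Mathlib

section
/- Let F(x) = P(p̂ ≤ x) and F₋(x) = P(p̂ < x) denote the CDF and strict CDF of the sample proportion p̂, computed under the true parameter p. Then P(F(p̂) < α/2 or F₋(p̂) > 1 − α/2) < α; consequently, with probability strictly greater than 1 − α, the true p lies in the confidence region {q ∈ (0,1) : F(p̂) ≥ α/2 and F₋(p̂) ≤ 1 − α/2} evaluated at q = p. -/
open scoped Classical in
/-- Probability that a Binomial(n,p) variable `X` satisfies predicate `Q`. -/
noncomputable def binProb (n : ℕ) (p : ℝ) (Q : ℕ → Prop) : ℝ :=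
  ∑ k ∈ Finset.range (n + 1),
    if Q k then (n.choose k : ℝ) * p ^ k * (1 - p) ^ (n - k) else 0

theorem binomial_weight_nonneg {p : ℝ} (hp : 0 ≤ p) (hp1 : p ≤ 1) (n k : ℕ) :
    0 ≤ (n.choose k : ℝ) * p ^ k * (1 - p) ^ (n - k) := by
  have : 0 ≤ 1 - p := sub_nonneg.2 hp1
  positivity

theorem binProb_mono {n : ℕ} {p : ℝ} (hp : 0 ≤ p) (hp1 : p ≤ 1) {Q R : ℕ → Prop}
    (h : ∀ k ∈ Finset.range (n + 1), Q k → R k) : binProb n p Q ≤ binProb n p R := by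
  unfold binProb
  refine Finset.sum_le_sum fun k hk => ?_
  have hw := binomial_weight_nonneg hp hp1 n k
  have hQR := h k hk
  split_ifs <;> first | exact le_rfl | exact hw | tauto

theorem binProb_or_le {n : ℕ} {p : ℝ} (hp : 0 ≤ p) (hp1 : p ≤ 1) (Q R : ℕ → Prop) :
    binProb n p (fun k => Q k ∨ R k) ≤ binProb n p Q + binProb n p R := by
  unfold binProb
  rw [← Finset.sum_add_distrib]
  refine Finset.sum_le_sum fun k _ => ?_
  have hw := binomial_weight_nonneg hp hp1 n k
  split_ifs <;> first | linarith | tauto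

theorem binProb_add_binProb_not (n : ℕ) (p : ℝ) (Q : ℕ → Prop) :
    binProb n p Q + binProb n p (fun k => ¬ Q k) = 1 := by
  unfold binProb
  rw [← Finset.sum_add_distrib]
  calc _ = ∑ k ∈ Finset.range (n + 1), p ^ k * (1 - p) ^ (n - k) * (n.choose k : ℝ) := by
        refine Finset.sum_congr rfl fun k _ => ?_
        by_cases hQ : Q k <;> simp [hQ] <;> ring
    _ = 1 := by rw [← add_pow]; simp

theorem binProb_eq_zero {n : ℕ} (p : ℝ) {Q : ℕ → Prop}
    (h : ∀ k ∈ Finset.range (n + 1), ¬ Q k) : binProb n p Q = 0 :=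
  Finset.sum_eq_zero fun k hk => if_neg (h k hk)

/-- The CDF of a statistic `t X`, evaluated at `t X`, falls below `a` with probability
less than `a`. -/
theorem binProb_cdf_lt {n : ℕ} {p a : ℝ} (hp : 0 ≤ p) (hp1 : p ≤ 1) (ha : 0 < a) (t : ℕ → ℝ) :
    binProb n p (fun k => binProb n p (fun j => t j ≤ t k) < a) < a := by
  classical
  rcases ((Finset.range (n + 1)).filter
    fun k => binProb n p (fun j => t j ≤ t k) < a).eq_empty_or_nonempty with hS | hS
  · rwa [binProb_eq_zero p (Finset.filter_eq_empty_iff.1 hS)]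
  · obtain ⟨m, hm, hmax⟩ := Finset.exists_max_image _ t hS
    refine (binProb_mono hp hp1 fun k hk hlt => ?_).trans_lt (Finset.mem_filter.1 hm).2
    exact hmax k (Finset.mem_filter.2 ⟨hk, hlt⟩)

/-- The strict CDF of a statistic `t X`, evaluated at `t X`, exceeds `1 - a` with probability
less than `a`. -/
theorem binProb_lt_strict_cdf {n : ℕ} {p a : ℝ} (hp : 0 ≤ p) (hp1 : p ≤ 1) (ha : 0 < a)
    (t : ℕ → ℝ) :
    binProb n p (fun k => 1 - a < binProb n p (fun j => t j < t k)) < a := by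
  refine lt_of_eq_of_lt ?_ (binProb_cdf_lt (n := n) hp hp1 ha fun k => -t k)
  congr 1
  funext k
  have h := binProb_add_binProb_not n p (fun j => t j < t k)
  simp only [neg_le_neg_iff, not_lt] at h ⊢
  exact propext ⟨fun _ => by linarith, fun _ => by linarith⟩

/-- with `F(x) = P(p̂ ≤ x)` and `F₋(x) = P(p̂ < x)` (where `p̂ = X/n`),
we have `P(F(p̂) < α/2 or F₋(p̂) > 1 − α/2) < α`, and consequently the event
`{F(p̂) ≥ α/2 and F₋(p̂) ≤ 1 − α/2}` has probability strictly greater than `1 − α`. -/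
theorem stmt0 (n : ℕ) (hn : 1 ≤ n) (p α : ℝ) (hp : 0 < p) (hp1 : p < 1)
    (hα : 0 < α) (hα1 : α < 1)
    (F Fm : ℝ → ℝ)
    (hF : ∀ x, F x = binProb n p (fun k => (k : ℝ) / n ≤ x))
    (hFm : ∀ x, Fm x = binProb n p (fun k => (k : ℝ) / n < x)) :
    binProb n p (fun k => F ((k : ℝ) / n) < α / 2 ∨ Fm ((k : ℝ) / n) > 1 - α / 2) < α ∧
    binProb n p (fun k => α / 2 ≤ F ((k : ℝ) / n) ∧ Fm ((k : ℝ) / n) ≤ 1 - α / 2) > 1 - α := by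
  have hlower := binProb_cdf_lt (n := n) hp.le hp1.le (half_pos hα) fun k => (k : ℝ) / n
  have hupper := binProb_lt_strict_cdf (n := n) hp.le hp1.le (half_pos hα) fun k => (k : ℝ) / n
  simp only [← hF] at hlower
  simp only [← hFm] at hupper
  have hreject : binProb n p
      (fun k => F ((k : ℝ) / n) < α / 2 ∨ Fm ((k : ℝ) / n) > 1 - α / 2) < α :=
    (binProb_or_le hp.le hp1.le _ _).trans_lt (by simp only [gt_iff_lt]; linarith)
  refine ⟨hreject, ?_⟩
  have hnot := binProb_add_binProb_not n p
    (fun k => F ((k : ℝ) / n) < α / 2 ∨ Fm ((k : ℝ) / n) > 1 - α / 2)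
  simp only [not_or, not_lt, gt_iff_lt] at hnot hreject ⊢
  linarith
end

section
/- Let z = z_{1−α/2}. Define the CLT bounds p̂_u^{CLT} = p̂ + z√(p̂(1−p̂)/n), p̂_l^{CLT} = p̂ − z√(p̂(1−p̂)/n), and the Wilson bounds p̂_u^{Wilson} = (1 + 2np̂/z² + √(1 + 4np̂(1−p̂)/z²)) / (2(1 + n/z²)), p̂_l^{Wilson} = (1 + 2np̂/z² − √(1 + 4np̂(1−p̂)/z²)) / (2(1 + n/z²)). Then for every integer n ≥ 1 and every p̂ ∈ [0,1]: |p̂_u^{Wilson} − p̂_u^{CLT}| ≤ z²/n + z³/(2n^{3/2}) and |p̂_l^{Wilson} − p̂_l^{CLT}| ≤ z²/n + z³/(2n^{3/2}). -/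
open MeasureTheory

/-- The standard normal CDF. -/
noncomputable def Phi (x : ℝ) : ℝ :=
  ∫ t in Set.Iic x, Real.exp (-(t ^ 2) / 2) / Real.sqrt (2 * Real.pi)

open ProbabilityTheory

theorem Phi_eq_gaussianReal_real (x : ℝ) : Phi x = (gaussianReal 0 1).real (Set.Iic x) := by
  rw [Measure.real, gaussianReal_apply_eq_integral 0 one_ne_zero,
    ENNReal.toReal_ofReal (integral_nonneg fun y => gaussianPDFReal_nonneg 0 1 y), Phi]
  congr 1 with t
  simp [gaussianPDFReal, div_eq_mul_inv, mul_comm]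

theorem Phi_mono : Monotone Phi := fun x y h => by
  rw [Phi_eq_gaussianReal_real, Phi_eq_gaussianReal_real]
  exact measureReal_mono (Set.Iic_subset_Iic.2 h)

theorem Phi_zero : Phi 0 = 1 / 2 := by
  have hsymm : (gaussianReal 0 1).real (Set.Ici 0) = (gaussianReal 0 1).real (Set.Iic 0) := by
    have h : (gaussianReal 0 1).map (fun x : ℝ => -x) = gaussianReal 0 1 := by
      simpa using gaussianReal_map_neg (μ := 0) (v := 1)
    conv_lhs => rw [← h]
    rw [map_measureReal_apply measurable_neg measurableSet_Ici]
    congr 1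
    ext x
    simp
  have := nullSingletonClass_gaussianReal (μ := 0) one_ne_zero
  have hsum := probReal_add_probReal_compl (μ := gaussianReal 0 1)
    (measurableSet_Iic (a := (0 : ℝ)))
  rw [Set.compl_Iic, measureReal_congr Ioi_ae_eq_Ici, hsymm] at hsum
  rw [Phi_eq_gaussianReal_real]
  linarith

theorem pos_of_half_lt_Phi {z : ℝ} (h : 1 / 2 < Phi z) : 0 < z := by
  by_contra! hz
  have := Phi_mono hz
  rw [Phi_zero] at this
  linarith

/-- The Wilson and CLT bounds in terms of `t = z / √n`, `r = √(p (1 - p))` and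
`S = √(t² + 4 r²)`. -/
theorem abs_wilson_sub_clt_le {t p r S : ℝ} (ht : 0 < t) (hp : 0 ≤ p) (hp1 : p ≤ 1) (hr : 0 ≤ r)
    (hr2 : r ^ 2 = p * (1 - p)) (hS : 0 ≤ S) (hS2 : S ^ 2 = t ^ 2 + 4 * r ^ 2) :
    |(t ^ 2 + 2 * p + t * S) / (2 * (1 + t ^ 2)) - (p + t * r)| ≤ t ^ 2 + t ^ 3 / 2 ∧
    |(t ^ 2 + 2 * p - t * S) / (2 * (1 + t ^ 2)) - (p - t * r)| ≤ t ^ 2 + t ^ 3 / 2 := by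
  have hr1 : 2 * r ≤ 1 := by nlinarith [sq_nonneg (2 * p - 1)]
  have hSl : 2 * r ≤ S := by nlinarith
  have hSu : S ≤ t + 2 * r := by nlinarith [mul_nonneg ht.le hr]
  have hD : 0 < 2 * (1 + t ^ 2) := by positivity
  have h1 : 0 ≤ t * (S - 2 * r) := mul_nonneg ht.le (by linarith)
  have h2 : 0 ≤ t * (t + 2 * r - S) := mul_nonneg ht.le (by linarith)
  have h3 : 0 ≤ t ^ 2 * p := by positivity
  have h4 : 0 ≤ t ^ 2 * (1 - p) := mul_nonneg (by positivity) (by linarith)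
  have h5 : 0 ≤ t ^ 3 * r := by positivity
  have h6 : 0 ≤ t ^ 3 * (1 - 2 * r) := mul_nonneg (by positivity) (by linarith)
  have h7 : 0 < t ^ 3 := by positivity
  have h8 : 0 < t ^ 4 := by positivity
  have h9 : 0 < t ^ 5 := by positivity
  constructor <;> rw [abs_le, le_sub_iff_add_le, sub_le_iff_le_add, le_div_iff₀ hD, div_le_iff₀ hD]
  all_goals constructor <;> linarith

/-- with `z = z_{1−α/2}`, for every `n ≥ 1` and `p̂ ∈ [0,1]`, the Wilson
upper/lower bounds differ from the CLT upper/lower bounds by at most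
`z²/n + z³/(2 n^{3/2})`. -/
theorem stmt4 (α z : ℝ) (hα : 0 < α) (hα1 : α < 1) (hz : Phi z = 1 - α / 2) :
    ∀ n : ℕ, 1 ≤ n → ∀ phat : ℝ, 0 ≤ phat → phat ≤ 1 →
    |(1 + 2 * n * phat / z ^ 2 + Real.sqrt (1 + 4 * n * phat * (1 - phat) / z ^ 2)) /
        (2 * (1 + (n : ℝ) / z ^ 2))
      - (phat + z * Real.sqrt (phat * (1 - phat) / n))|
      ≤ z ^ 2 / n + z ^ 3 / (2 * (n : ℝ) ^ ((3 : ℝ) / 2)) ∧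
    |(1 + 2 * n * phat / z ^ 2 - Real.sqrt (1 + 4 * n * phat * (1 - phat) / z ^ 2)) /
        (2 * (1 + (n : ℝ) / z ^ 2))
      - (phat - z * Real.sqrt (phat * (1 - phat) / n))|
      ≤ z ^ 2 / n + z ^ 3 / (2 * (n : ℝ) ^ ((3 : ℝ) / 2)) := by
  intro n hn p hp hp1
  have hz0 : 0 < z := pos_of_half_lt_Phi (by linarith)
  have hn0 : (0 : ℝ) < n := by exact_mod_cast hn
  obtain ⟨m, hm, hmn⟩ : ∃ m : ℝ, 0 < m ∧ (n : ℝ) = m ^ 2 :=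
    ⟨√n, Real.sqrt_pos.2 hn0, (Real.sq_sqrt hn0.le).symm⟩
  obtain ⟨t, ht, rfl⟩ : ∃ t : ℝ, 0 < t ∧ z = t * m :=
    ⟨z / m, by positivity, by field_simp⟩
  have hq : 0 ≤ p * (1 - p) := mul_nonneg hp (by linarith)
  have hpow : (n : ℝ) ^ ((3 : ℝ) / 2) = m ^ 3 := by
    rw [hmn, ← Real.rpow_natCast, ← Real.rpow_mul hm.le, ← Real.rpow_natCast]
    norm_num
  have hclt : √(p * (1 - p) / n) = √(p * (1 - p)) / m := by
    rw [Real.sqrt_div hq, hmn, Real.sqrt_sq hm.le]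
  have hwilson : √(1 + 4 * n * p * (1 - p) / (t * m) ^ 2)
      = √(t ^ 2 + 4 * √(p * (1 - p)) ^ 2) / t := by
    rw [Real.sq_sqrt hq, hmn, eq_div_iff ht.ne']
    conv_lhs => rw [← Real.sqrt_sq ht.le, ← Real.sqrt_mul' _ (sq_nonneg _), Real.sqrt_sq ht.le]
    congr 1
    field_simp
  have key := abs_wilson_sub_clt_le ht hp hp1 (Real.sqrt_nonneg _) (Real.sq_sqrt hq)
    (Real.sqrt_nonneg (t ^ 2 + 4 * √(p * (1 - p)) ^ 2)) (Real.sq_sqrt (by positivity))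
  rw [hpow, hclt, hwilson, hmn]
  convert key using 3 <;> field_simp
  all_goals ring
end

section
/- Let u ∈ (0,1) be any constant with 4C²/(u²α²) < z_{(1−u)α/2}², and for an integer n and p̂ ∈ [0,1] define C̃ = min(C/√(p̂(1−p̂)), u√n·α/2) (with C̃ = u√n·α/2 when p̂ = 0 or p̂ = 1), λ = 1 − 2C̃/(√n·α), N0 = max((4C/(uα))², 12 z_{(1−u)α/2}² C² / (z_{(1−u)α/2}² u²α² − 4C²)), p̂_u^{BE} = (1 + 2np̂/z_{λα/2}² + √(1 + 4np̂(1−p̂)/z_{λα/2}²)) / (2(1 + n/z_{λα/2}²)), and p̂_u^{CLT} = p̂ + z_{1−α/2}√(p̂(1−p̂)/n). Then there exists a constant C0, depending only on α, u and C (not on p̂ or n), such that for every integer n > N0 and every p̂ ∈ [0,1]: |p̂_u^{BE} − p̂_u^{CLT}| ≤ C0/n. -/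
open MeasureTheory

/-- The density of the standard normal distribution is integrable. -/
theorem integrable_normal_density :
    Integrable fun t : ℝ => Real.exp (-(t ^ 2) / 2) / Real.sqrt (2 * Real.pi) := by
  refine ((integrable_exp_neg_mul_sq (b := 1 / 2) (by norm_num)).div_const
    (Real.sqrt (2 * Real.pi))).congr ?_
  filter_upwards with t
  congr 2
  ring

/-- The density of the standard normal distribution has total mass one. -/
theorem integral_normal_density :
    ∫ t : ℝ, Real.exp (-(t ^ 2) / 2) / Real.sqrt (2 * Real.pi) = 1 := by
  have h := integral_gaussian (1 / 2)
  have h2 : (fun t : ℝ => Real.exp (-(t ^ 2) / 2)) = fun t => Real.exp (-(1 / 2) * t ^ 2) := by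
    funext t
    congr 1
    ring
  rw [integral_div, h2, h, show Real.pi / (1 / 2) = 2 * Real.pi by ring]
  exact div_self (by positivity)

theorem Phi_neg (x : ℝ) : Phi (-x) = 1 - Phi x := by
  have hsplit := integral_add_compl (measurableSet_Iic (a := x)) integrable_normal_density
  rw [integral_normal_density, Set.compl_Iic] at hsplit
  have hrefl := integral_comp_neg_Iic (-x)
    (fun t : ℝ => Real.exp (-(t ^ 2) / 2) / Real.sqrt (2 * Real.pi))
  simp only [neg_sq, neg_neg] at hrefl
  unfold Phi
  linarith

/-- On `[-M, M]` the standard normal CDF grows at least at the rate given by its density at `M`. -/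
theorem density_mul_sub_le_Phi_sub {M x y : ℝ} (hx : -M ≤ x) (hxy : x ≤ y) (hy : y ≤ M) :
    Real.exp (-(M ^ 2) / 2) / Real.sqrt (2 * Real.pi) * (y - x) ≤ Phi y - Phi x := by
  have hint := integrable_normal_density
  unfold Phi
  rw [intervalIntegral.integral_Iic_sub_Iic hint.integrableOn hint.integrableOn]
  have hconst : Real.exp (-(M ^ 2) / 2) / Real.sqrt (2 * Real.pi) * (y - x) =
      ∫ _ in x..y, Real.exp (-(M ^ 2) / 2) / Real.sqrt (2 * Real.pi) := by
    rw [intervalIntegral.integral_const, smul_eq_mul, mul_comm]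
  rw [hconst]
  refine intervalIntegral.integral_mono_on hxy intervalIntegrable_const
    hint.intervalIntegrable fun t ht => ?_
  have hsq : t ^ 2 ≤ M ^ 2 := sq_le_sq' (by linarith [ht.1]) (by linarith [ht.2])
  gcongr

theorem Phi_strictMono : StrictMono Phi := by
  intro x y hxy
  have h := density_mul_sub_le_Phi_sub (M := max (-x) y) (by linarith [le_max_left (-x) y])
    hxy.le (le_max_right _ _)
  have : 0 < Real.exp (-(max (-x) y ^ 2) / 2) / Real.sqrt (2 * Real.pi) * (y - x) :=
    mul_pos (by positivity) (by linarith)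
  linarith

/-- The upper endpoint of the Wilson score interval with critical value `a` differs from that of
the Wald interval by `O(1 / n)`, where `n = r ^ 2`. -/
theorem abs_wilson_sub_wald_le {a r p s : ℝ} (ha : 0 < a) (hr : 1 ≤ r) (hp0 : 0 ≤ p)
    (hp1 : p ≤ 1) (hs : 0 ≤ s) (hsp : s ^ 2 = p * (1 - p)) :
    |(1 + 2 * r ^ 2 * p / a ^ 2 + Real.sqrt (1 + 4 * r ^ 2 * p * (1 - p) / a ^ 2)) /
        (2 * (1 + r ^ 2 / a ^ 2)) - (p + a * (s / r))| ≤ (a ^ 2 + a ^ 3) / r ^ 2 := by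
  have hr0 : 0 < r := by linarith
  have hs1 : s ≤ 1 := by nlinarith
  set T := Real.sqrt (1 + 4 * r ^ 2 * p * (1 - p) / a ^ 2) with hT
  have hrad : 1 + 4 * r ^ 2 * p * (1 - p) / a ^ 2 = 1 + (2 * r * s / a) ^ 2 := by
    rw [div_pow, mul_pow, hsp]
    ring
  have hTlow : 2 * r * s / a ≤ T := by
    rw [hT, hrad]
    exact Real.le_sqrt_of_sq_le (by linarith)
  have hTup : T ≤ 1 + 2 * r * s / a := by
    rw [hT, hrad]
    have : 0 ≤ 2 * r * s / a := by positivity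
    exact Real.sqrt_le_iff.2 ⟨by positivity, by nlinarith⟩
  rw [div_le_iff₀ ha] at hTlow
  have hTup' : T * a ≤ a + 2 * r * s := by
    have := mul_le_mul_of_nonneg_right hTup ha.le
    rwa [add_mul, one_mul, div_mul_cancel₀ _ ha.ne'] at this
  have hden : 0 < 2 * (a ^ 2 + r ^ 2) := by positivity
  have key : (1 + 2 * r ^ 2 * p / a ^ 2 + T) / (2 * (1 + r ^ 2 / a ^ 2)) - (p + a * (s / r)) =
      (a ^ 2 * (1 - 2 * p) + a * (T * a - 2 * r * s) - 2 * a ^ 3 * (s / r)) /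
        (2 * (a ^ 2 + r ^ 2)) := by
    field_simp
    ring
  have hsr : s / r ≤ 1 := (div_le_one hr0).2 (hs1.trans hr)
  have hsr0 : 0 ≤ s / r := by positivity
  have ha3 : 0 < a ^ 3 := by positivity
  have hnum : |a ^ 2 * (1 - 2 * p) + a * (T * a - 2 * r * s) - 2 * a ^ 3 * (s / r)| ≤
      2 * (a ^ 2 + a ^ 3) := by
    have h1 : a ^ 3 * (s / r) ≤ a ^ 3 := mul_le_of_le_one_right ha3.le hsr
    have h2 : 0 ≤ a ^ 3 * (s / r) := by positivity
    have h3 : 0 ≤ a * (T * a - 2 * r * s) := mul_nonneg ha.le (by linarith)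
    have h4 : a * (T * a - 2 * r * s) ≤ a * a := mul_le_mul_of_nonneg_left (by linarith) ha.le
    have h5 : 0 ≤ a ^ 2 * p := by positivity
    have h6 : a ^ 2 * p ≤ a ^ 2 := mul_le_of_le_one_right (by positivity) hp1
    rw [abs_le]
    constructor <;> nlinarith
  rw [key, abs_div, abs_of_pos hden]
  calc _ ≤ 2 * (a ^ 2 + a ^ 3) / (2 * (a ^ 2 + r ^ 2)) := by gcongr
    _ = (a ^ 2 + a ^ 3) / (a ^ 2 + r ^ 2) := mul_div_mul_left _ _ two_ne_zero
    _ ≤ (a ^ 2 + a ^ 3) / r ^ 2 := by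
      gcongr
      nlinarith


/-- with `C̃`, `λ`, `N0`, `p̂_u^{BE}` and `p̂_u^{CLT}` as defined, there is a
constant `C0` (depending only on `α`, `u` and `C`) such that for every integer `n > N0`
and every `p̂ ∈ [0,1]`, `|p̂_u^{BE} − p̂_u^{CLT}| ≤ C0/n`. -/
theorem stmt8 (α C u : ℝ) (hα : 0 < α) (hα1 : α < 1) (hC : 0 < C) (hu : 0 < u) (hu1 : u < 1)
    (zq : ℝ → ℝ) (hzq : ∀ q : ℝ, 0 < q → q < 1 → Phi (zq q) = q)
    (hucond : 4 * C ^ 2 / (u ^ 2 * α ^ 2) < (zq ((1 - u) * α / 2)) ^ 2) :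
    ∃ C0 : ℝ, ∀ n : ℕ,
      (n : ℝ) > max ((4 * C / (u * α)) ^ 2)
        (12 * (zq ((1 - u) * α / 2)) ^ 2 * C ^ 2 /
          ((zq ((1 - u) * α / 2)) ^ 2 * u ^ 2 * α ^ 2 - 4 * C ^ 2)) →
      ∀ phat : ℝ, 0 ≤ phat → phat ≤ 1 →
      let Ctil : ℝ :=
        if phat = 0 ∨ phat = 1 then u * Real.sqrt n * α / 2
        else min (C / Real.sqrt (phat * (1 - phat))) (u * Real.sqrt n * α / 2)
      let lam : ℝ := 1 - 2 * Ctil / (Real.sqrt n * α)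
      let z : ℝ := zq (lam * α / 2)
      |(1 + 2 * n * phat / z ^ 2 + Real.sqrt (1 + 4 * n * phat * (1 - phat) / z ^ 2)) /
            (2 * (1 + (n : ℝ) / z ^ 2))
        - (phat + zq (1 - α / 2) * Real.sqrt (phat * (1 - phat) / n))| ≤ C0 / n := by
  set M := -zq ((1 - u) * α / 2) with hM
  set D := Real.exp (-(M ^ 2) / 2) / Real.sqrt (2 * Real.pi) with hD
  have hDpos : 0 < D := by positivity
  refine ⟨M ^ 2 + M ^ 3 + C / D, fun n hn p hp0 hp1 => ?_⟩
  intro Ctil lam z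
  have hn0 : (0 : ℝ) < n := (sq_nonneg _).trans_lt ((le_max_left _ _).trans_lt hn)
  have hn1 : (1 : ℝ) ≤ n := by exact_mod_cast (by exact_mod_cast hn0 : 0 < n)
  set r := Real.sqrt n with hr
  have hr1 : 1 ≤ r := Real.one_le_sqrt.2 hn1
  have hr0 : 0 < r := by linarith
  have hrn : (n : ℝ) = r ^ 2 := (Real.sq_sqrt hn0.le).symm
  have hpp : 0 ≤ p * (1 - p) := mul_nonneg hp0 (by linarith)
  set s := Real.sqrt (p * (1 - p)) with hs
  have hs0 : 0 ≤ s := Real.sqrt_nonneg _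
  have hsp : s ^ 2 = p * (1 - p) := Real.sq_sqrt hpp
  have hCtil : 0 ≤ Ctil ∧ Ctil ≤ u * r * α / 2 ∧ Ctil * s ≤ C := by
    have hcap : 0 ≤ u * r * α / 2 := by positivity
    by_cases h : p = 0 ∨ p = 1
    · have hs' : s = 0 := by rcases h with h | h <;> simp [hs, h]
      have hC' : Ctil = u * r * α / 2 := if_pos h
      rw [hC', hs', mul_zero]
      exact ⟨hcap, le_rfl, hC.le⟩
    · have hC' : Ctil = min (C / s) (u * r * α / 2) := if_neg h
      push Not at h
      have hspos : 0 < s := Real.sqrt_pos.2 <|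
        mul_pos (lt_of_le_of_ne hp0 (Ne.symm h.1)) (sub_pos.2 (lt_of_le_of_ne hp1 h.2))
      rw [hC']
      exact ⟨le_min (by positivity) hcap, min_le_right _ _,
        (le_div_iff₀ hspos).1 (min_le_left _ _)⟩
  obtain ⟨hCt0, hCtle, hCts⟩ := hCtil
  have hq : lam * α / 2 = α / 2 - Ctil / r := by
    simp only [lam, ← hr]
    field_simp
  have hCr0 : 0 ≤ Ctil / r := by positivity
  have hCr : Ctil / r ≤ u * α / 2 := by
    rw [div_le_iff₀ hr0]
    linarith
  have huα : 0 < (1 - u) * α := mul_pos (by linarith) hα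
  have huα' : (1 - u) * α ≤ α := mul_le_of_le_one_left hα.le (by linarith)
  have hPz : Phi z = α / 2 - Ctil / r := by
    rw [← hq]
    exact hzq _ (by rw [hq]; nlinarith) (by rw [hq]; linarith)
  have hPlow : Phi (-M) = (1 - u) * α / 2 := by
    rw [hM, neg_neg]
    exact hzq _ (by linarith) (by linarith)
  have hPc : Phi (zq (α / 2)) = α / 2 := hzq _ (by linarith) (by linarith)
  have hPup : zq (1 - α / 2) = -zq (α / 2) := by
    apply Phi_strictMono.injective
    rw [hzq _ (by linarith) (by linarith), Phi_neg, hPc]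
  have hP0 : Phi 0 = 1 / 2 := by
    have := Phi_neg 0
    rw [neg_zero] at this
    linarith
  have hMz : -M ≤ z := Phi_strictMono.le_iff_le.1 (by rw [hPlow, hPz]; linarith)
  have hzc : z ≤ zq (α / 2) := Phi_strictMono.le_iff_le.1 (by rw [hPc, hPz]; linarith)
  have hc0 : zq (α / 2) < 0 := Phi_strictMono.lt_iff_lt.1 (by rw [hPc, hP0]; linarith)
  have hlip : D * (zq (α / 2) - z) ≤ Ctil / r := by
    have := density_mul_sub_le_Phi_sub hMz hzc (by linarith)
    rw [hPc, hPz] at this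
    linarith
  have hwilson := abs_wilson_sub_wald_le (a := -z) (by linarith) hr1 hp0 hp1 hs0 hsp
  rw [neg_sq, ← hrn] at hwilson
  have hzM : (z ^ 2 + (-z) ^ 3) / n ≤ (M ^ 2 + M ^ 3) / n := by
    have h0 : 0 ≤ -z := by linarith
    have hle : -z ≤ M := by linarith
    rw [← neg_sq z]
    gcongr
  have hquant : |(-z - zq (1 - α / 2)) * (s / r)| ≤ C / D / n := by
    rw [hPup, abs_of_nonneg (mul_nonneg (by linarith) (by positivity)), hrn]
    rw [div_div, le_div_iff₀ (by positivity)]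
    calc (-z - -zq (α / 2)) * (s / r) * (D * r ^ 2)
        = D * (zq (α / 2) - z) * (s * r) := by field_simp; ring
      _ ≤ Ctil / r * (s * r) := by gcongr
      _ = Ctil * s := by field_simp
      _ ≤ C := hCts
  rw [Real.sqrt_div hpp, ← hs, ← hr, add_div _ (C / D)]
  refine le_trans ?_ (add_le_add (hwilson.trans hzM) hquant)
  refine le_of_eq_of_le ?_ (abs_add_le _ _)
  congr 1
  ring
end

section
/- The set {q ∈ (0,1) : q^{n0}(1−q)^{N−n0} ≥ (α/2)·(n0/N)^{n0}·(1−n0/N)^{N−n0}} is a valid (1−α)-level confidence region for p; that is, P( p^{n0}(1−p)^{N−n0} ≥ (α/2)·(n0/N)^{n0}·(1−n0/N)^{N−n0} ) ≥ 1 − α. -/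
open scoped Classical in
/-- Probability that the negative-binomial sample size `N` (number of Bernoulli(p) trials
until `n0` successes) satisfies predicate `Q`. -/
noncomputable def nbProb (n0 : ℕ) (p : ℝ) (Q : ℕ → Prop) : ℝ :=
  ∑' k : ℕ,
    if Q (n0 + k) then ((n0 + k - 1).choose (n0 - 1) : ℝ) * p ^ n0 * (1 - p) ^ k else 0

/-- The negative-binomial weights `C(n0+k-1, n0-1) q^{n0} (1-q)^k` sum to `1`. -/
theorem hasSum_negBinomial (n0 : ℕ) (hn0 : 1 ≤ n0) (q : ℝ) (hq : 0 < q) (hq1 : q ≤ 1) :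
    HasSum (fun k : ℕ => ((n0 + k - 1).choose (n0 - 1) : ℝ) * q ^ n0 * (1 - q) ^ k) 1 := by
  obtain ⟨m, rfl⟩ : ∃ m, n0 = m + 1 := ⟨n0 - 1, by omega⟩
  have hr : ‖1 - q‖ < 1 := by
    rw [Real.norm_eq_abs, abs_lt]
    constructor <;> linarith
  have h := (hasSum_choose_mul_geometric_of_norm_lt_one m hr).mul_left (q ^ (m + 1))
  have hone : q ^ (m + 1) * (1 / (1 - (1 - q)) ^ (m + 1)) = 1 := by
    rw [sub_sub_cancel]
    field_simp
  rw [hone] at h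
  refine h.congr_fun ?_
  intro k
  rw [show m + 1 + k - 1 = k + m by omega, Nat.add_sub_cancel]
  ring

/-- A likelihood-ratio bound in favour of a larger success probability `q` at `k` failures
persists for fewer failures. -/
theorem likelihood_le_of_le {n0 j k : ℕ} {p q c : ℝ} (hp1 : p < 1) (hq : 0 < q) (hpq : p ≤ q)
    (hq1 : q ≤ 1) (hc : 0 ≤ c) (hjk : j ≤ k)
    (h : p ^ n0 * (1 - p) ^ k ≤ c * (q ^ n0 * (1 - q) ^ k)) :
    p ^ n0 * (1 - p) ^ j ≤ c * (q ^ n0 * (1 - q) ^ j) := by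
  obtain ⟨d, rfl⟩ := Nat.exists_eq_add_of_le hjk
  have hq' : 0 ≤ 1 - q := by linarith
  have hd : (1 - q) ^ d ≤ (1 - p) ^ d := by gcongr
  have hpos : 0 < (1 - p) ^ d := pow_pos (by linarith) d
  refine le_of_mul_le_mul_right ?_ hpos
  calc p ^ n0 * (1 - p) ^ j * (1 - p) ^ d
      = p ^ n0 * (1 - p) ^ (j + d) := by ring
    _ ≤ c * (q ^ n0 * (1 - q) ^ (j + d)) := h
    _ = c * (q ^ n0 * (1 - q) ^ j) * (1 - q) ^ d := by ring
    _ ≤ c * (q ^ n0 * (1 - q) ^ j) * (1 - p) ^ d := by gcongr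

/-- A likelihood-ratio bound in favour of a smaller success probability `q` at `k` failures
persists for more failures. -/
theorem likelihood_le_of_ge {n0 j k : ℕ} {p q c : ℝ} (hp1 : p ≤ 1) (hq : 0 < q) (hqp : q ≤ p)
    (hc : 0 ≤ c) (hkj : k ≤ j)
    (h : p ^ n0 * (1 - p) ^ k ≤ c * (q ^ n0 * (1 - q) ^ k)) :
    p ^ n0 * (1 - p) ^ j ≤ c * (q ^ n0 * (1 - q) ^ j) := by
  obtain ⟨d, rfl⟩ := Nat.exists_eq_add_of_le hkj
  have hp' : 0 ≤ 1 - p := by linarith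
  have hq' : 0 ≤ 1 - q := by linarith
  calc p ^ n0 * (1 - p) ^ (k + d)
      = p ^ n0 * (1 - p) ^ k * (1 - p) ^ d := by ring
    _ ≤ c * (q ^ n0 * (1 - q) ^ k) * (1 - q) ^ d := by gcongr
    _ = c * (q ^ n0 * (1 - q) ^ (k + d)) := by ring

/-- Among the outcomes whose maximum-likelihood estimate is at least `p` and whose likelihood
ratio is below `c`, a single alternative `q` dominates `p` uniformly. -/
theorem exists_dominating_of_le_estimate (n0 : ℕ) (hn0 : 1 ≤ n0) {p c : ℝ} (hp : 0 < p)
    (hp1 : p < 1) (hc : 0 ≤ c) :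
    ∃ q : ℝ, 0 < q ∧ q ≤ 1 ∧ ∀ k : ℕ, p ≤ (n0 : ℝ) / (n0 + k : ℕ) →
      p ^ n0 * (1 - p) ^ k ≤
        c * (((n0 : ℝ) / (n0 + k : ℕ)) ^ n0 * (1 - (n0 : ℝ) / (n0 + k : ℕ)) ^ k) →
      p ^ n0 * (1 - p) ^ k ≤ c * (q ^ n0 * (1 - q) ^ k) := by
  set S : Set ℕ := {k | p ≤ (n0 : ℝ) / (n0 + k : ℕ) ∧ p ^ n0 * (1 - p) ^ k ≤
    c * (((n0 : ℝ) / (n0 + k : ℕ)) ^ n0 * (1 - (n0 : ℝ) / (n0 + k : ℕ)) ^ k)}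
  have hn : (0 : ℝ) < n0 := by exact_mod_cast hn0
  have hbdd : BddAbove S := by
    refine ⟨⌈(n0 : ℝ) / p⌉₊, fun k hk => ?_⟩
    have hk1 := hk.1
    rw [le_div_iff₀ (by positivity)] at hk1
    have hle : (k : ℝ) ≤ (n0 : ℝ) / p := by
      rw [le_div_iff₀ hp]
      push_cast at hk1
      nlinarith
    exact_mod_cast hle.trans (Nat.le_ceil _)
  by_cases hne : S.Nonempty
  · have hmem := Nat.sSup_mem hne hbdd
    have hq : 0 < (n0 : ℝ) / (n0 + sSup S : ℕ) := by positivity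
    have hq1 : (n0 : ℝ) / (n0 + sSup S : ℕ) ≤ 1 := by
      apply div_le_one_of_le₀ <;> push_cast <;> [skip; positivity]
      linarith [Nat.cast_nonneg (α := ℝ) (sSup S)]
    exact ⟨_, hq, hq1, fun k hk1 hk2 =>
      likelihood_le_of_le hp1 hq hmem.1 hq1 hc (le_csSup hbdd ⟨hk1, hk2⟩) hmem.2⟩
  · exact ⟨1, one_pos, le_rfl, fun k hk1 hk2 => absurd ⟨k, hk1, hk2⟩ hne⟩

/-- Among the outcomes whose maximum-likelihood estimate is at most `p` and whose likelihood
ratio is below `c`, a single alternative `q` dominates `p` uniformly. -/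
theorem exists_dominating_of_estimate_le (n0 : ℕ) (hn0 : 1 ≤ n0) {p c : ℝ}
    (hp1 : p ≤ 1) (hc : 0 ≤ c) :
    ∃ q : ℝ, 0 < q ∧ q ≤ 1 ∧ ∀ k : ℕ, (n0 : ℝ) / (n0 + k : ℕ) ≤ p →
      p ^ n0 * (1 - p) ^ k ≤
        c * (((n0 : ℝ) / (n0 + k : ℕ)) ^ n0 * (1 - (n0 : ℝ) / (n0 + k : ℕ)) ^ k) →
      p ^ n0 * (1 - p) ^ k ≤ c * (q ^ n0 * (1 - q) ^ k) := by
  set S : Set ℕ := {k | (n0 : ℝ) / (n0 + k : ℕ) ≤ p ∧ p ^ n0 * (1 - p) ^ k ≤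
    c * (((n0 : ℝ) / (n0 + k : ℕ)) ^ n0 * (1 - (n0 : ℝ) / (n0 + k : ℕ)) ^ k)}
  by_cases hne : S.Nonempty
  · have hmem := Nat.sInf_mem hne
    have hn : (0 : ℝ) < n0 := by exact_mod_cast hn0
    have hq : 0 < (n0 : ℝ) / (n0 + sInf S : ℕ) := by positivity
    exact ⟨_, hq, hmem.1.trans hp1, fun k hk1 hk2 =>
      likelihood_le_of_ge hp1 hq hmem.1 hc (Nat.sInf_le (show k ∈ S from ⟨hk1, hk2⟩)) hmem.2⟩
  · exact ⟨1, one_pos, le_rfl, fun k hk1 hk2 => absurd ⟨k, hk1, hk2⟩ hne⟩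

/-- the Chernoff confidence region
`{q : q^{n0}(1−q)^{N−n0} ≥ (α/2)(n0/N)^{n0}(1−n0/N)^{N−n0}}` covers the true `p` with
probability at least `1 − α`. -/
theorem stmt9 (n0 : ℕ) (hn0 : 1 ≤ n0) (p α : ℝ) (hp : 0 < p) (hp1 : p < 1)
    (hα : 0 < α) (hα1 : α < 1) :
    nbProb n0 p (fun m =>
      p ^ n0 * (1 - p) ^ (m - n0) ≥
        α / 2 * ((n0 : ℝ) / m) ^ n0 * (1 - (n0 : ℝ) / m) ^ (m - n0)) ≥ 1 - α := by
  have hc : 0 ≤ α / 2 := by positivity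
  obtain ⟨q, hq, hq1, hqdom⟩ := exists_dominating_of_le_estimate n0 hn0 hp hp1 hc
  obtain ⟨r, hr, hr1, hrdom⟩ := exists_dominating_of_estimate_le n0 hn0 hp1.le hc
  have hsp := hasSum_negBinomial n0 hn0 p hp hp1.le
  have hsum := (hsp.sub ((hasSum_negBinomial n0 hn0 q hq hq1).mul_left (α / 2))).sub
    ((hasSum_negBinomial n0 hn0 r hr hr1).mul_left (α / 2))
  rw [show (1 : ℝ) - α / 2 * 1 - α / 2 * 1 = 1 - α by ring] at hsum
  have hp' : 0 ≤ 1 - p := by linarith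
  have hq' : 0 ≤ 1 - q := by linarith
  have hr' : 0 ≤ 1 - r := by linarith
  rw [ge_iff_le, ← hsum.tsum_eq, nbProb]
  refine hsum.summable.tsum_le_tsum (fun k => ?_) (hsp.summable.of_nonneg_of_le ?_ ?_)
  · have hbq : 0 ≤ α / 2 * (((n0 + k - 1).choose (n0 - 1) : ℝ) * q ^ n0 * (1 - q) ^ k) := by
      positivity
    have hbr : 0 ≤ α / 2 * (((n0 + k - 1).choose (n0 - 1) : ℝ) * r ^ n0 * (1 - r) ^ k) := by
      positivity
    split_ifs with hgood
    · linarith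
    · rw [Nat.add_sub_cancel_left, ge_iff_le, not_le, mul_assoc] at hgood
      have hb : (0 : ℝ) ≤ (n0 + k - 1).choose (n0 - 1) := Nat.cast_nonneg _
      rcases le_total p ((n0 : ℝ) / (n0 + k : ℕ)) with hle | hle
      · have := mul_le_mul_of_nonneg_left (hqdom k hle hgood.le) hb
        linarith
      · have := mul_le_mul_of_nonneg_left (hrdom k hle hgood.le) hb
        linarith
  · intro k
    split_ifs <;> positivity
  · intro k
    split_ifs
    · exact le_rfl
    · positivity
end

section
/- Assume p < 1/2. Then the probability of the event that either (p ≤ n0/N and Φ((Np − n0)/√(n0(1−p))) + C'/√(n0(1−p)³) ≥ α/2) or (n0/N ≤ p and Φ((n0 − Np)/√(n0(1−p))) + C'/√(n0(1−p)³) ≥ α/2) is at least 1 − α. -/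
open MeasureTheory

/-- The point mass of the negative-binomial distribution at `n0 + k`. -/
noncomputable def nbWeight (n0 : ℕ) (p : ℝ) (k : ℕ) : ℝ :=
  ((n0 + k - 1).choose (n0 - 1) : ℝ) * p ^ n0 * (1 - p) ^ k

lemma nbWeight_nonneg (n0 : ℕ) {p : ℝ} (hp : 0 ≤ p) (hp1 : p ≤ 1) (k : ℕ) :
    0 ≤ nbWeight n0 p k := by
  have : 0 ≤ 1 - p := by linarith
  unfold nbWeight
  positivity

lemma hasSum_nbWeight {n0 : ℕ} (hn0 : 1 ≤ n0) {p : ℝ} (hp : 0 < p) (hp1 : p ≤ 1) :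
    HasSum (nbWeight n0 p) 1 := by
  obtain ⟨j, rfl⟩ : ∃ j, n0 = j + 1 := ⟨n0 - 1, by omega⟩
  have hr : ‖1 - p‖ < 1 := by
    rw [Real.norm_eq_abs, abs_lt]
    constructor <;> linarith
  have h := (hasSum_choose_mul_geometric_of_norm_lt_one j hr).mul_left (p ^ (j + 1))
  have hone : p ^ (j + 1) * (1 / (1 - (1 - p)) ^ (j + 1)) = 1 := by
    rw [sub_sub_cancel]
    field_simp
  rw [hone] at h
  refine h.congr_fun ?_
  intro k
  have hk : j + 1 + k - 1 = k + j := by omega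
  simp only [nbWeight, hk, Nat.add_sub_cancel]
  ring

open scoped Classical in
lemma nbProb_eq_tsum_nbWeight (n0 : ℕ) (p : ℝ) (Q : ℕ → Prop) :
    nbProb n0 p Q = ∑' k, if Q (n0 + k) then nbWeight n0 p k else 0 := rfl

open scoped Classical in
lemma summable_ite_nbWeight {n0 : ℕ} (hn0 : 1 ≤ n0) {p : ℝ} (hp : 0 < p) (hp1 : p ≤ 1)
    (Q : ℕ → Prop) : Summable fun k => if Q (n0 + k) then nbWeight n0 p k else 0 := by
  refine (hasSum_nbWeight hn0 hp hp1).summable.of_nonneg_of_le (fun k => ?_) (fun k => ?_) <;>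
    have := nbWeight_nonneg n0 hp.le hp1 k <;> split_ifs <;> simp [this]

lemma nbProb_mono {n0 : ℕ} (hn0 : 1 ≤ n0) {p : ℝ} (hp : 0 < p) (hp1 : p ≤ 1)
    {Q R : ℕ → Prop} (h : ∀ m, Q m → R m) : nbProb n0 p Q ≤ nbProb n0 p R := by
  classical
  rw [nbProb_eq_tsum_nbWeight, nbProb_eq_tsum_nbWeight]
  refine (summable_ite_nbWeight hn0 hp hp1 Q).tsum_le_tsum (fun k => ?_)
    (summable_ite_nbWeight hn0 hp hp1 R)
  have := nbWeight_nonneg n0 hp.le hp1 k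
  have := h (n0 + k)
  split_ifs <;> simp_all

lemma nbProb_eq_zero (n0 : ℕ) (p : ℝ) {Q : ℕ → Prop} (h : ∀ m, ¬ Q m) : nbProb n0 p Q = 0 := by
  simp [nbProb, h]

/-- The union bound for three events that cover the whole sample space. -/
lemma one_le_nbProb_add_add {n0 : ℕ} (hn0 : 1 ≤ n0) {p : ℝ} (hp : 0 < p) (hp1 : p ≤ 1)
    {Q R S : ℕ → Prop} (h : ∀ m, n0 ≤ m → Q m ∨ R m ∨ S m) :
    1 ≤ nbProb n0 p Q + nbProb n0 p R + nbProb n0 p S := by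
  classical
  have hQ := summable_ite_nbWeight hn0 hp hp1 Q
  have hR := summable_ite_nbWeight hn0 hp hp1 R
  have hS := summable_ite_nbWeight hn0 hp hp1 S
  rw [nbProb_eq_tsum_nbWeight, nbProb_eq_tsum_nbWeight, nbProb_eq_tsum_nbWeight,
    ← hQ.tsum_add hR, ← (hQ.add hR).tsum_add hS, ← (hasSum_nbWeight hn0 hp hp1).tsum_eq]
  refine (hasSum_nbWeight hn0 hp hp1).summable.tsum_le_tsum (fun k => ?_) ((hQ.add hR).add hS)
  have hw := nbWeight_nonneg n0 hp.le hp1 k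
  have := h (n0 + k) (by omega)
  split_ifs <;> first | linarith | tauto

/-- A bounded event on which the lower tail is at most `c` has probability at most `c`. -/
lemma nbProb_le_of_lower_tail_le {n0 : ℕ} (hn0 : 1 ≤ n0) {p c : ℝ} (hp : 0 < p) (hp1 : p ≤ 1)
    (hc : 0 ≤ c) {Q : ℕ → Prop} (hQ : {m | Q m}.Finite)
    (htail : ∀ m, Q m → nbProb n0 p (fun j => (j : ℝ) ≤ m) ≤ c) : nbProb n0 p Q ≤ c := by
  by_cases hne : ∃ m, Q m
  · obtain ⟨M, hM, hmax⟩ := Set.exists_max_image {m | Q m} id hQ hne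
    exact (nbProb_mono hn0 hp hp1 fun m hm => Nat.cast_le.2 (hmax m hm)).trans (htail M hM)
  · rw [nbProb_eq_zero n0 p (not_exists.1 hne)]
    exact hc

/-- An event on which the upper tail is at most `c` has probability at most `c`. -/
lemma nbProb_le_of_upper_tail_le {n0 : ℕ} (hn0 : 1 ≤ n0) {p c : ℝ} (hp : 0 < p) (hp1 : p ≤ 1)
    (hc : 0 ≤ c) {Q : ℕ → Prop}
    (htail : ∀ m, Q m → nbProb n0 p (fun j => (j : ℝ) ≥ m) ≤ c) : nbProb n0 p Q ≤ c := by
  classical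
  by_cases hne : ∃ m, Q m
  · exact (nbProb_mono hn0 hp hp1 fun m hm => Nat.cast_le.2 (Nat.find_min' hne hm)).trans
      (htail _ (Nat.find_spec hne))
  · rw [nbProb_eq_zero n0 p (not_exists.1 hne)]
    exact hc

/-- assuming `p < 1/2` and the Berry–Esseen-type bound with constant `C'`,
the Berry–Esseen confidence region for the targeted-stopping setting covers the true `p`
with probability at least `1 − α`. -/
theorem stmt10 (n0 : ℕ) (hn0 : 1 ≤ n0) (p α C' : ℝ) (hp : 0 < p) (hp2 : p < 1 / 2)
    (hα : 0 < α) (hα1 : α < 1) (hC' : 0 < C')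
    (hBE1 : ∀ x : ℝ,
      |nbProb n0 p (fun m => (m : ℝ) ≤ x)
          - Phi ((x * p - n0) / Real.sqrt (n0 * (1 - p)))|
        ≤ C' / Real.sqrt (n0 * (1 - p) ^ 3))
    (hBE2 : ∀ x : ℝ,
      |nbProb n0 p (fun m => (m : ℝ) ≥ x)
          - Phi ((n0 - x * p) / Real.sqrt (n0 * (1 - p)))|
        ≤ C' / Real.sqrt (n0 * (1 - p) ^ 3)) :
    nbProb n0 p (fun m =>
      (p ≤ (n0 : ℝ) / m ∧
        Phi (((m : ℝ) * p - n0) / Real.sqrt (n0 * (1 - p)))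
          + C' / Real.sqrt (n0 * (1 - p) ^ 3) ≥ α / 2) ∨
      ((n0 : ℝ) / m ≤ p ∧
        Phi (((n0 : ℝ) - m * p) / Real.sqrt (n0 * (1 - p)))
          + C' / Real.sqrt (n0 * (1 - p) ^ 3) ≥ α / 2)) ≥ 1 - α := by
  have hp1 : p ≤ 1 := by linarith
  set s := Real.sqrt (n0 * (1 - p))
  set ε := C' / Real.sqrt (n0 * (1 - p) ^ 3)
  have hlow : nbProb n0 p (fun m => (m : ℝ) ≤ n0 / p ∧
      Phi (((m : ℝ) * p - n0) / s) + ε < α / 2) ≤ α / 2 := by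
    refine nbProb_le_of_lower_tail_le hn0 hp hp1 (by positivity) ?_ ?_
    · exact (Set.finite_Iic ⌊(n0 : ℝ) / p⌋₊).subset fun m hm => Nat.le_floor hm.1
    · intro m hm
      linarith [hm.2, (abs_le.1 (hBE1 m)).2]
  have hupp : nbProb n0 p (fun m => Phi (((n0 : ℝ) - m * p) / s) + ε < α / 2) ≤ α / 2 := by
    refine nbProb_le_of_upper_tail_le hn0 hp hp1 (by positivity) ?_
    intro m hm
    linarith [(abs_le.1 (hBE2 m)).2]
  have hcover := one_le_nbProb_add_add hn0 hp hp1 (p := p)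
    (Q := fun m => (p ≤ (n0 : ℝ) / m ∧ Phi (((m : ℝ) * p - n0) / s) + ε ≥ α / 2) ∨
      ((n0 : ℝ) / m ≤ p ∧ Phi (((n0 : ℝ) - m * p) / s) + ε ≥ α / 2))
    (R := fun m => (m : ℝ) ≤ n0 / p ∧ Phi (((m : ℝ) * p - n0) / s) + ε < α / 2)
    (S := fun m => Phi (((n0 : ℝ) - m * p) / s) + ε < α / 2) (by
      intro m hm
      have hm0 : (0 : ℝ) < m := Nat.cast_pos.2 (by omega)
      rcases le_total p ((n0 : ℝ) / m) with h | h
      · rcases le_or_gt (α / 2) (Phi (((m : ℝ) * p - n0) / s) + ε) with h' | h'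
        · exact Or.inl (Or.inl ⟨h, h'⟩)
        · exact Or.inr (Or.inl ⟨(le_div_comm₀ hp hm0).1 h, h'⟩)
      · rcases le_or_gt (α / 2) (Phi (((n0 : ℝ) - m * p) / s) + ε) with h' | h'
        · exact Or.inl (Or.inr ⟨h, h'⟩)
        · exact Or.inr (Or.inr h'))
  linarith
end

section
/- Let G be a geometric random variable on {1,2,…} with P(G = k) = (1−p)^{k−1} p, where p ∈ (0,1). Then the third absolute central-type moment satisfies E|pG − 1|³ ≤ p² − 12p + 16 ≤ 16; i.e., ∑_{k≥1} |pk − 1|³ (1−p)^{k−1} p ≤ 16. -/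
theorem two_mul_cast_choose_add_two (j : ℕ) :
    2 * ((j + 2).choose 2 : ℝ) = (j + 1) * (j + 2) := by
  rw [Nat.cast_choose_two]
  push_cast
  ring

theorem six_mul_cast_choose_add_three (j : ℕ) :
    6 * ((j + 3).choose 3 : ℝ) = (j + 1) * (j + 2) * (j + 3) := by
  induction j with
  | zero => norm_num
  | succ j ih =>
    have h : (j + 1 + 3).choose 3 = (j + 3).choose 2 + (j + 3).choose 3 :=
      Nat.choose_succ_succ _ _
    have h' := two_mul_cast_choose_add_two (j + 1)
    rw [show j + 1 + 2 = j + 3 by ring] at h'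
    rw [h]
    push_cast at h' ⊢
    linear_combination ih + 3 * h'

/-- If `G` is geometric with success probability `p`, then `E[(pG - 1)³ + 2] = p² - 3p + 4`. -/
theorem hasSum_geometric_cube_add_two {p : ℝ} (hp : 0 < p) (hp1 : p < 1) :
    HasSum (fun j : ℕ => ((p * ((j + 1 : ℕ) : ℝ) - 1) ^ 3 + 2) * (1 - p) ^ j * p)
      (p ^ 2 - 3 * p + 4) := by
  have hr : ‖1 - p‖ < 1 := by
    rw [Real.norm_eq_abs, abs_lt]
    constructor <;> linarith
  have h0 := (hasSum_choose_mul_geometric_of_norm_lt_one 0 hr).mul_left p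
  have h1 := (hasSum_choose_mul_geometric_of_norm_lt_one 1 hr).mul_left
    (p * (p ^ 3 + 3 * p ^ 2 + 3 * p))
  have h2 := (hasSum_choose_mul_geometric_of_norm_lt_one 2 hr).mul_left
    (p * (-6 * p ^ 3 - 6 * p ^ 2))
  have h3 := (hasSum_choose_mul_geometric_of_norm_lt_one 3 hr).mul_left (p * (6 * p ^ 3))
  convert ((h0.add h1).add h2).add h3 using 1
  · rfl
  · funext j
    have e2 := two_mul_cast_choose_add_two j
    have e3 := six_mul_cast_choose_add_three j
    simp only [add_zero, Nat.choose_zero_right, Nat.choose_one_right]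
    push_cast
    linear_combination (3 * p ^ 3 + 3 * p ^ 2) * (1 - p) ^ j * p * e2
      - p ^ 3 * (1 - p) ^ j * p * e3
  · have hp0 : p ≠ 0 := hp.ne'
    rw [sub_sub_cancel]
    field_simp
    ring

theorem abs_sub_one_pow_three_le {x : ℝ} (hx : 0 ≤ x) : |x - 1| ^ 3 ≤ (x - 1) ^ 3 + 2 := by
  rcases le_total 1 x with h | h
  · rw [abs_of_nonneg (by linarith)]
    linarith
  · rw [abs_of_nonpos (by linarith)]
    have : (1 - x) ^ 3 ≤ 1 := pow_le_one₀ (by linarith) (by linarith)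
    linear_combination 2 * this

/-- for a geometric random variable `G` on `{1,2,…}` with
`P(G = k) = (1−p)^{k−1} p`, the third absolute moment of `pG − 1` satisfies
`E|pG − 1|³ ≤ p² − 12p + 16 ≤ 16`. (The sum over `k ≥ 1` is written with `k = j + 1`.) -/
theorem stmt14 (p : ℝ) (hp : 0 < p) (hp1 : p < 1) :
    (∑' j : ℕ, |p * ((j + 1 : ℕ) : ℝ) - 1| ^ 3 * (1 - p) ^ j * p) ≤ p ^ 2 - 12 * p + 16 ∧
    p ^ 2 - 12 * p + 16 ≤ 16 := by
  refine ⟨?_, by nlinarith⟩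
  have hq : 0 ≤ 1 - p := by linarith
  have hs := hasSum_geometric_cube_add_two hp hp1
  have hle : ∀ j : ℕ, |p * ((j + 1 : ℕ) : ℝ) - 1| ^ 3 * (1 - p) ^ j * p ≤
      ((p * ((j + 1 : ℕ) : ℝ) - 1) ^ 3 + 2) * (1 - p) ^ j * p := fun j => by
    gcongr
    exact abs_sub_one_pow_three_le (by positivity)
  have hsum := Summable.of_nonneg_of_le (fun j => by positivity) hle hs.summable
  have := hsum.tsum_le_tsum hle hs.summable
  rw [hs.tsum_eq] at this
  linarith
end

section
/- Let n ≥ 1 be an integer, α ∈ (0,1), and p̂ ∈ [0,1]. (i) If 0 < p ≤ p̂ and exp(−((p̂/p − 1)²/(1 + p̂/p))·np) ≥ α/2, then p ≥ p̂ + log(2/α)/(2n) − √((log(2/α))²/(4n²) + 2p̂ log(2/α)/n). (ii) If p̂ ≤ p < 1 and exp(−(1 − p̂/p)²·np/2) ≥ α/2, then p ≤ p̂ + log(2/α)/n + √((log(2/α))²/n² + 2p̂ log(2/α)/n). -/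
/-- A lower bound `c / 2 ≤ exp (-(x * N))` bounds `x` by `log (2 / c) / N`. -/
lemma le_log_two_div_div_of_half_le_exp {c x N : ℝ} (hc : 0 < c) (hN : 0 < N)
    (h : c / 2 ≤ Real.exp (-(x * N))) : x ≤ Real.log (2 / c) / N := by
  have h1 : Real.log (c / 2) ≤ -(x * N) := (Real.log_le_iff_le_exp (by positivity)).2 h
  have h2 : Real.log (2 / c) = -Real.log (c / 2) := by rw [← Real.log_inv, inv_div]
  rw [le_div_iff₀ hN]
  linarith

/-- (i) if `0 < p ≤ p̂` and `exp(−((p̂/p − 1)²/(1 + p̂/p))·np) ≥ α/2` then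
`p ≥ p̂ + log(2/α)/(2n) − √((log(2/α))²/(4n²) + 2p̂ log(2/α)/n)`; (ii) if `p̂ ≤ p < 1` and
`exp(−(1 − p̂/p)²·np/2) ≥ α/2` then
`p ≤ p̂ + log(2/α)/n + √((log(2/α))²/n² + 2p̂ log(2/α)/n)`. -/
theorem stmt19 (n : ℕ) (hn : 1 ≤ n) (α phat : ℝ) (hα : 0 < α) (hα1 : α < 1)
    (hphat0 : 0 ≤ phat) (hphat1 : phat ≤ 1) :
    (∀ p : ℝ, 0 < p → p ≤ phat →
      Real.exp (-((phat / p - 1) ^ 2 / (1 + phat / p) * (n * p))) ≥ α / 2 →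
      p ≥ phat + Real.log (2 / α) / (2 * n) -
        Real.sqrt ((Real.log (2 / α)) ^ 2 / (4 * (n : ℝ) ^ 2)
          + 2 * phat * Real.log (2 / α) / n)) ∧
    (∀ p : ℝ, phat ≤ p → p < 1 →
      Real.exp (-((1 - phat / p) ^ 2 * (n * p) / 2)) ≥ α / 2 →
      p ≤ phat + Real.log (2 / α) / n +
        Real.sqrt ((Real.log (2 / α)) ^ 2 / (n : ℝ) ^ 2
          + 2 * phat * Real.log (2 / α) / n)) := by
  have hN : (0 : ℝ) < n := by exact_mod_cast hn
  have hL : 0 < Real.log (2 / α) := Real.log_pos (by rw [lt_div_iff₀ hα]; linarith)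
  refine ⟨fun p hp hpq h => ?_, fun p hqp _ h => ?_⟩
  · have hx : (phat - p) ^ 2 / (p + phat) ≤ Real.log (2 / α) / n := by
      refine le_log_two_div_div_of_half_le_exp hα hN (h.trans_eq ?_)
      congr 2
      field_simp
    rw [div_le_iff₀ (by linarith)] at hx
    have hs : phat - p + Real.log (2 / α) / (2 * n) ≤
        Real.sqrt ((Real.log (2 / α)) ^ 2 / (4 * (n : ℝ) ^ 2)
          + 2 * phat * Real.log (2 / α) / n) := by
      apply Real.le_sqrt_of_sq_le
      calc (phat - p + Real.log (2 / α) / (2 * n)) ^ 2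
          = (phat - p) ^ 2 + (phat - p) * (Real.log (2 / α) / n)
            + (Real.log (2 / α)) ^ 2 / (4 * (n : ℝ) ^ 2) := by field_simp; ring
        _ ≤ Real.log (2 / α) / n * (p + phat) + (phat - p) * (Real.log (2 / α) / n)
            + (Real.log (2 / α)) ^ 2 / (4 * (n : ℝ) ^ 2) := by gcongr
        _ = _ := by ring
    linarith
  · rcases (hphat0.trans hqp).eq_or_lt with rfl | hp
    · positivity
    have hx : (p - phat) ^ 2 / (2 * p) ≤ Real.log (2 / α) / n := by
      refine le_log_two_div_div_of_half_le_exp hα hN (h.trans_eq ?_)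
      congr 2
      field_simp
    rw [div_le_iff₀ (by linarith)] at hx
    have hs : p - phat - Real.log (2 / α) / n ≤
        Real.sqrt ((Real.log (2 / α)) ^ 2 / (n : ℝ) ^ 2
          + 2 * phat * Real.log (2 / α) / n) := by
      apply Real.le_sqrt_of_sq_le
      calc (p - phat - Real.log (2 / α) / n) ^ 2
          = (p - phat) ^ 2 - 2 * (p - phat) * (Real.log (2 / α) / n)
            + (Real.log (2 / α)) ^ 2 / (n : ℝ) ^ 2 := by ring
        _ ≤ Real.log (2 / α) / n * (2 * p) - 2 * (p - phat) * (Real.log (2 / α) / n)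
            + (Real.log (2 / α)) ^ 2 / (n : ℝ) ^ 2 := by gcongr
        _ = _ := by ring
    linarith
end
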